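/- arXiv:1412.5842 — 2 statements merged into one kernel-verified Lean document; each statement's English description precedes it below -/
import Mathlib

section
/- Assume d ≥ 2 and n = 2t−1 ≥ 5. Define S ⊆ A_d^n as the union of three sets: (i) all x ∈ A_d^n such that for some m ∈ A_d and some ℓ with 1 ≤ ℓ < t−1 the substring x^{(t,m)}(t+1−ℓ : n−1) is ℓ-periodic but x^{(t,m)}(t+1−ℓ : n−1) ⊕ (x_n+m mod d) is not; (ii) all x ∈ A_d^n such that x_t ≠ x_n and x^{(t,m)}(t+1−ℓ : n−1) is not ℓ-periodic for any m ∈ A_d and any ℓ with 1 ≤ ℓ < t−1; (iii) all x ∈ A_d^n such that x^{(t,m)}(1 : n−1) is almost t-periodic for some m ∈ A_d. Then S is a t-identifying code of the directed de Bruijn graph B⃗(d,n) of cardinality d^{n−1}(d−1) + d^t. -/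
/- Common framework: the directed de Bruijn graph B⃗(d,n).
Vertices are strings of length `n` over the alphabet `A_d = Fin d`,
modelled as functions `Fin n → Fin d` (0-indexed; the paper's 1-indexed
position `i` corresponds to index `i - 1` here). -/

namespace DeBruijnPaper

/-- Vertices of the directed de Bruijn graph: strings of length `n` over `Fin d`. -/
abbrev Vtx (d n : ℕ) := Fin n → Fin d

/-- Directed edge from `x = x₁⋯xₙ` to `y = y₁⋯yₙ`:
`x₂x₃⋯xₙ = y₁y₂⋯y_{n−1}`. -/
def adj (d n : ℕ) (x y : Vtx d n) : Prop :=
  ∀ (i : ℕ) (h : i + 1 < n), x ⟨i + 1, h⟩ = y ⟨i, by omega⟩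

/-- There is a directed walk of length `t` from `x` to `y`. -/
def hasWalk (d n : ℕ) (t : ℕ) (x y : Vtx d n) : Prop :=
  ∃ f : ℕ → Vtx d n, f 0 = x ∧ f t = y ∧ ∀ i < t, adj d n (f i) (f (i + 1))

/-- Directed distance `d⃗(x,y)`: the length of a shortest directed path
(equivalently walk) from `x` to `y`. -/
noncomputable def dirDist (d n : ℕ) (x y : Vtx d n) : ℕ :=
  sInf {t : ℕ | hasWalk d n t x y}

/-- The in-ball `B_t^−(v) = {u : d⃗(u,v) ≤ t}`. -/
def inBall (d n t : ℕ) (v : Vtx d n) : Set (Vtx d n) :=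
  {u : Vtx d n | dirDist d n u v ≤ t}

/-- `S` is a `t`-identifying code: every vertex has a nonempty identifying set
`B_t^−(v) ∩ S`, and distinct vertices have distinct identifying sets. -/
def IsIdCode (d n t : ℕ) (S : Set (Vtx d n)) : Prop :=
  (∀ v : Vtx d n, (inBall d n t v ∩ S).Nonempty) ∧
    ∀ u v : Vtx d n, u ≠ v → inBall d n t u ∩ S ≠ inBall d n t v ∩ S

/-- `S` is a (directed) `t`-dominating set. -/
def IsDomSet (d n t : ℕ) (S : Set (Vtx d n)) : Prop :=
  ∀ v : Vtx d n, (inBall d n t v ∩ S).Nonempty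

/-- `S` is a directed resolving set. -/
def IsResolving (d n : ℕ) (S : Set (Vtx d n)) : Prop :=
  ∀ u v : Vtx d n, u ≠ v → ∃ s ∈ S, dirDist d n s u ≠ dirDist d n s v

/-- The directed metric dimension: minimum size of a directed resolving set. -/
noncomputable def metricDim (d n : ℕ) : ℕ :=
  sInf {k : ℕ | ∃ S : Set (Vtx d n), IsResolving d n S ∧ S.ncard = k}

/-- `π` is an automorphism of the directed de Bruijn graph. -/
def IsAut (d n : ℕ) (π : Equiv.Perm (Vtx d n)) : Prop :=
  ∀ x y : Vtx d n, adj d n x y ↔ adj d n (π x) (π y)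

/-- `S` is a determining set. -/
def IsDetSet (d n : ℕ) (S : Set (Vtx d n)) : Prop :=
  ∀ π : Equiv.Perm (Vtx d n), IsAut d n π → (∀ s ∈ S, π s = s) → π = 1

/-- The determining number: minimum size of a determining set. -/
noncomputable def detNum (d n : ℕ) : ℕ :=
  sInf {k : ℕ | ∃ S : Set (Vtx d n), IsDetSet d n S ∧ S.ncard = k}

/-- `w` (of length `N`) has period length `ℓ` (a positive period is intended):
`N ≥ 2ℓ` and `w_i = w_{i+ℓ}` for all valid `i` (paper is 1-indexed, here 0-indexed). -/
def HasPeriod {d N : ℕ} (w : Fin N → Fin d) (ℓ : ℕ) : Prop :=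
  2 * ℓ ≤ N ∧ ∀ (i : ℕ) (h : i + ℓ < N), w ⟨i, by omega⟩ = w ⟨i + ℓ, h⟩

/-- `w` is `ℓ`-periodic: it has period length `ℓ` but no (positive) period length `k < ℓ`. -/
def IsPeriodic {d N : ℕ} (w : Fin N → Fin d) (ℓ : ℕ) : Prop :=
  HasPeriod w ℓ ∧ ∀ k : ℕ, 1 ≤ k → k < ℓ → ¬ HasPeriod w k

/-- `w` is almost `ℓ`-periodic: `ℓ > N/2` and some extension `w ⊕ w'` of length `2ℓ`
is `ℓ`-periodic. -/
def AlmostPeriodic {d N : ℕ} (w : Fin N → Fin d) (ℓ : ℕ) : Prop :=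
  N < 2 * ℓ ∧ ∃ w' : Fin (2 * ℓ - N) → Fin d, IsPeriodic (Fin.append w w') ℓ

/-- `w^{(k,m)}` where `k` is the 0-indexed position: add `m` (mod `d`) to the `k`-th letter.
(The paper's 1-indexed `w^{(k,m)}` is `modify w (k-1) m` here.) -/
def modify {d N : ℕ} (w : Fin N → Fin d) (k : ℕ) (m : Fin d) : Fin N → Fin d :=
  fun i => if i.val = k then w i + m else w i

/-- `w(a:b)`: the substring `w_a w_{a+1} ⋯ w_b`, with `a`, `b` 1-indexed as in the paper. -/
def substr {d N : ℕ} (w : Fin N → Fin d) (a b : ℕ) (ha : 1 ≤ a) (hb : b ≤ N) :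
    Fin (b + 1 - a) → Fin d :=
  fun i => w ⟨a - 1 + i.val, by have := i.isLt; omega⟩

/-- `g` repeats with step `ℓ` on the index interval `[lo, hi)`. -/
def RepeatsOn {α : Type*} (g : ℕ → α) (lo hi ℓ : ℕ) : Prop :=
  ∀ i, lo ≤ i → i + ℓ < hi → g i = g (i + ℓ)

/-- Putting the letter `a` in the central position `s` makes `g` periodic, with least period `ℓ`,
on the window of length `s - 1 + ℓ` that ends just before position `2 * s`. -/
def CentralPeriod {α : Type*} (s : ℕ) (g : ℕ → α) (a : α) (ℓ : ℕ) : Prop :=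
  1 ≤ ℓ ∧ ℓ < s ∧ RepeatsOn (Function.update g s a) (s + 1 - ℓ) (2 * s) ℓ ∧
    ∀ k, 1 ≤ k → k < ℓ → ¬ RepeatsOn (Function.update g s a) (s + 1 - ℓ) (2 * s) k

open Classical in
/-- The only value of `g (2 * s) - g s` for which a word fails the first two conditions that
define the code. -/
noncomputable def excludedDiff {α : Type*} [AddCommGroup α] (s : ℕ) (g : ℕ → α) : α :=
  if h : ∃ p : α × ℕ, CentralPeriod s g p.1 p.2 then g (2 * s - h.choose.2) - h.choose.1 else 0

/-- Membership in the code, for words of length `2 * s + 1` read as functions on `ℕ`. -/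
def InCode {α : Type*} [AddCommGroup α] (s : ℕ) (g : ℕ → α) : Prop :=
  g (2 * s) - g s ≠ excludedDiff s g ∨ ∀ i, i + 1 < s → g i = g (i + s + 1)

/-- The in-ball relation of radius `s + 1`, for words of length `2 * s + 1` read as functions
on `ℕ`. -/
def Reaches {α : Type*} (s : ℕ) (x g : ℕ → α) : Prop :=
  ∃ j ≤ s + 1, ∀ i, i + j < 2 * s + 1 → x (i + j) = g i

/-- The word `b⋯b g₀g₁⋯`, with `j` copies of `b`. -/
def padLeft {α : Type*} (j : ℕ) (b : α) (g : ℕ → α) : ℕ → α :=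
  fun i => if i < j then b else g (i - j)

section Words

variable {α : Type*}

lemma padLeft_of_lt {j i : ℕ} (b : α) (g : ℕ → α) (h : i < j) : padLeft j b g i = b :=
  if_pos h

lemma padLeft_of_le {j i : ℕ} (b : α) (g : ℕ → α) (h : j ≤ i) :
    padLeft j b g i = g (i - j) :=
  if_neg h.not_gt

lemma padLeft_add (j i : ℕ) (b : α) (g : ℕ → α) : padLeft j b g (i + j) = g i := by
  rw [padLeft_of_le b g (Nat.le_add_left j i), Nat.add_sub_cancel]

lemma padLeft_congr {j N : ℕ} (b : α) {g h : ℕ → α} (hgh : ∀ i < N - j, g i = h i) {i : ℕ}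
    (hi : i < N) : padLeft j b g i = padLeft j b h i := by
  rw [padLeft, padLeft]
  split_ifs
  · rfl
  · exact hgh _ (by omega)

/-- A word of length `p + 1 + q` that satisfies every relation of the periods `p + 1` and `q`
except possibly the one between positions `p` and `p + q` satisfies that one too. -/
lemma eq_of_two_periods (f : ℕ → α) (lo p q : ℕ)
    (h₁ : ∀ k < p, f (lo + k + q) = f (lo + k))
    (h₂ : ∀ k < q, f (lo + k) = f (lo + (p + 1) + k)) :
    f (lo + p + q) = f (lo + p) := by
  classical
  set φ : ℕ → ℕ := fun i => if f i = f (lo + p) then 1 else 0 with hφ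
  have e₁ : ∑ k ∈ Finset.range (p + 1 + q), φ (lo + k) =
      ∑ k ∈ Finset.range (p + 1), φ (lo + k) + ∑ k ∈ Finset.range q, φ (lo + (p + 1 + k)) :=
    Finset.sum_range_add _ _ _
  have e₂ : ∑ k ∈ Finset.range (q + (p + 1)), φ (lo + k) =
      ∑ k ∈ Finset.range q, φ (lo + k) + ∑ k ∈ Finset.range (p + 1), φ (lo + (q + k)) :=
    Finset.sum_range_add _ _ _
  have e₃ : ∑ k ∈ Finset.range q, φ (lo + k) = ∑ k ∈ Finset.range q, φ (lo + (p + 1 + k)) := by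
    refine Finset.sum_congr rfl fun k hk => ?_
    have := h₂ k (Finset.mem_range.1 hk)
    simp only [hφ, this, add_assoc]
  have e₄ : ∑ k ∈ Finset.range p, φ (lo + k) = ∑ k ∈ Finset.range p, φ (lo + (q + k)) := by
    refine Finset.sum_congr rfl fun k hk => ?_
    have := h₁ k (Finset.mem_range.1 hk)
    rw [show lo + k + q = lo + (q + k) by ring] at this
    simp only [hφ, this]
  rw [Finset.sum_range_succ] at e₁ e₂
  rw [add_comm q (p + 1)] at e₂
  have key : φ (lo + (q + p)) = φ (lo + p) := by omega
  rw [show lo + (q + p) = lo + p + q by ring] at key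
  by_contra hne
  simp [hφ, hne] at key

lemma CentralPeriod.congr {s : ℕ} {g g' : ℕ → α} (h : ∀ i < 2 * s, i ≠ s → g i = g' i)
    {a : α} {ℓ : ℕ} (hg : CentralPeriod s g a ℓ) : CentralPeriod s g' a ℓ := by
  have e : ∀ i < 2 * s, Function.update g s a i = Function.update g' s a i := by
    intro i hi
    by_cases his : i = s
    · simp [his]
    · simp [his, h i hi his]
  have e' : ∀ lo k, RepeatsOn (Function.update g s a) lo (2 * s) k ↔
      RepeatsOn (Function.update g' s a) lo (2 * s) k := by
    intro lo k
    refine forall_congr' fun i => forall_congr' fun _ => forall_congr' fun hi => ?_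
    rw [e i (by omega), e (i + k) hi]
  obtain ⟨h1, h2, h3, h4⟩ := hg
  exact ⟨h1, h2, (e' _ _).1 h3, fun k hk hk' hr => h4 k hk hk' ((e' _ _).2 hr)⟩

lemma CentralPeriod.letter_eq {s : ℕ} {g : ℕ → α} {a : α} {ℓ : ℕ}
    (h : CentralPeriod s g a ℓ) : g (s + ℓ) = a := by
  obtain ⟨h1, h2, h3, -⟩ := h
  have := h3 s (by omega) (by omega)
  rw [Function.update_self, Function.update_of_ne (by omega)] at this
  exact this.symm

lemma CentralPeriod.letters_eq {s : ℕ} {g : ℕ → α} {a a' : α} {ℓ ℓ' : ℕ}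
    (h : CentralPeriod s g a ℓ) (h' : CentralPeriod s g a' ℓ') (hlt : ℓ < ℓ') : a = a' := by
  have ha := h.letter_eq
  have ha' := h'.letter_eq
  obtain ⟨h1, h2, h3, -⟩ := h
  obtain ⟨h1', h2', h3', -⟩ := h'
  have := eq_of_two_periods (Function.update g s a) (s + 1 - ℓ) (ℓ - 1) ℓ' ?_ ?_
  · rw [show s + 1 - ℓ + (ℓ - 1) = s by omega, Function.update_self,
      Function.update_of_ne (by omega), ha'] at this
    exact this.symm
  · intro k hk
    have := h3' (s + 1 - ℓ + k) (by omega) (by omega)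
    rw [Function.update_of_ne (by omega), Function.update_of_ne (by omega)] at this ⊢
    exact this.symm
  · intro k hk
    have := h3 (s + 1 - ℓ + k) (by omega) (by omega)
    rw [this]
    congr 1
    omega

lemma CentralPeriod.not_lt {s : ℕ} {g : ℕ → α} {a a' : α} {ℓ ℓ' : ℕ}
    (h : CentralPeriod s g a ℓ) (h' : CentralPeriod s g a' ℓ') : ¬ ℓ < ℓ' := by
  intro hlt
  obtain rfl := h.letters_eq h' hlt
  obtain ⟨h1, h2, h3, -⟩ := h
  obtain ⟨h1', h2', h3', h4'⟩ := h'
  refine h4' ℓ h1 hlt fun i hi hi' => ?_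
  by_cases hc : s + 1 - ℓ ≤ i
  · exact h3 i hc hi'
  · rw [h3' i hi (by omega), h3 (i + ℓ') (by omega) (by omega),
      h3' (i + ℓ) (by omega) (by omega)]
    congr 1
    omega

lemma CentralPeriod.unique {s : ℕ} {g : ℕ → α} {a a' : α} {ℓ ℓ' : ℕ}
    (h : CentralPeriod s g a ℓ) (h' : CentralPeriod s g a' ℓ') : a = a' ∧ ℓ = ℓ' := by
  have hl : ℓ = ℓ' := by
    have := h.not_lt h'
    have := h'.not_lt h
    omega
  subst hl
  exact ⟨h.letter_eq.symm.trans h'.letter_eq, rfl⟩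

/-- If two words agree before position `p` and differ there, they do not both have short periods
up to and including position `p`. -/
lemma not_two_periods {g h : ℕ → α} {s j q q' : ℕ} (hs : 1 ≤ s) (hj : j ≤ s)
    (hgh : ∀ i < 2 * s - j, g i = h i) (hne : g (2 * s - j) ≠ h (2 * s - j))
    (hq : 1 ≤ q) (hq' : 1 ≤ q') (hqj : q + j ≤ s + 1) (hqj' : q' + j ≤ s + 1)
    (hg : ∀ k, k + q ≤ 2 * s - j → g (k + q) = g k)
    (hh : ∀ k, k + q' ≤ 2 * s - j → h (k + q') = h k) : False := by
  obtain ⟨p, hp⟩ : ∃ p, p = 2 * s - j := ⟨_, rfl⟩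
  rw [← hp] at hgh hne hg hh
  have G : ∀ k m, m = k + q → m ≤ p → g m = g k := fun k m e hm => e ▸ hg k (e ▸ hm)
  have H : ∀ k m, m = k + q' → m ≤ p → h m = h k := fun k m e hm => e ▸ hh k (e ▸ hm)
  have swap : ∀ {g h : ℕ → α}, (∀ i < 2 * s, g i = h i) →
      (∀ k m, m = k + s → m ≤ 2 * s → g m = g k) →
      (∀ k m, m = k + (s + 1) → m ≤ 2 * s → h m = h k) → 1 ≤ s → g (2 * s) = h (2 * s) := by
    intro g h hgh G H hs
    have const : ∀ i < s, g i = g 0 := by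
      intro i
      induction i with
      | zero => simp
      | succ i ih =>
        intro hi
        rw [← ih (by omega), hgh i (by omega), ← H i (i + 1 + s) (by omega) (by omega),
          ← hgh _ (by omega), G (i + 1) (i + 1 + s) rfl (by omega)]
    rw [G s (2 * s) (by omega) le_rfl, G 0 s (by omega) (by omega),
      H (s - 1) (2 * s) (by omega) le_rfl, ← hgh _ (by omega), const (s - 1) (by omega)]
  apply hne
  by_cases hqq : q = q'
  · subst hqq
    rw [G (p - q) p (by omega) le_rfl, H (p - q) p (by omega) le_rfl, hgh _ (by omega)]
  by_cases hle : q + q' ≤ p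
  · rw [G (p - q) p (by omega) le_rfl, H (p - q') p (by omega) le_rfl, hgh _ (by omega),
      H (p - q - q') (p - q) (by omega) (by omega), ← hgh (p - q') (by omega),
      G (p - q - q') (p - q') (by omega) (by omega), hgh _ (by omega)]
  · obtain ⟨rfl, hqs⟩ : j = 0 ∧ (q = s ∧ q' = s + 1 ∨ q = s + 1 ∧ q' = s) := by omega
    obtain rfl : p = 2 * s := by omega
    rcases hqs with ⟨rfl, rfl⟩ | ⟨rfl, rfl⟩
    · exact swap hgh G H hq
    · exact (swap (fun i hi => (hgh i hi).symm) H G hq').symm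

/-- If `b⋯b g₀g₁⋯` lies in the ball around `h`, then `g` has a short period; here `g` and
`h` first differ in position `2 * s - j`, and there are `j` copies of `b`. -/
lemma exists_period_of_reaches {s j : ℕ} {g h : ℕ → α} {b : α} (hj : j ≤ s)
    (hgh : ∀ i < 2 * s - j, g i = h i) (hne : g (2 * s - j) ≠ h (2 * s - j))
    (hb : b ≠ h 0) (hr : Reaches s (padLeft j b g) h) :
    ∃ q, 1 ≤ q ∧ q + j ≤ s + 1 ∧ ∀ k, k + q ≤ 2 * s - j → g (k + q) = g k := by
  obtain ⟨i, hi, hr⟩ := hr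
  rcases lt_trichotomy i j with hij | rfl | hij
  · have := hr 0 (by omega)
    rw [padLeft_of_lt _ _ (by omega)] at this
    exact absurd this hb
  · have := hr (2 * s - i) (by omega)
    rw [padLeft_add] at this
    exact absurd this hne
  · refine ⟨i - j, by omega, by omega, fun k hk => ?_⟩
    have := hr k (by omega)
    rw [padLeft_of_le _ _ (by omega)] at this
    rw [hgh k (by omega), ← this]
    congr 1
    omega

lemma not_reaches_of_prefix_ne {s : ℕ} {g h : ℕ → α} {b : α} (hgh : ∃ i < s, g i ≠ h i)
    (hb : b ≠ h 0) : ¬ Reaches s (padLeft (s + 1) b g) h := by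
  rintro ⟨j, hj, hr⟩
  rcases hj.lt_or_eq with hj | rfl
  · have := hr 0 (by omega)
    rw [padLeft_of_lt _ _ (by omega)] at this
    exact hb this
  · obtain ⟨i, hi, hne⟩ := hgh
    have := hr i (by omega)
    rw [padLeft_add] at this
    exact hne this

variable [AddCommGroup α]

lemma excludedDiff_eq {s : ℕ} {g : ℕ → α} {a : α} {ℓ : ℕ} (h : CentralPeriod s g a ℓ) :
    excludedDiff s g = g (2 * s - ℓ) - a := by
  have hex : ∃ p : α × ℕ, CentralPeriod s g p.1 p.2 := ⟨(a, ℓ), h⟩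
  obtain ⟨h1, h2⟩ := hex.choose_spec.unique h
  rw [excludedDiff, dif_pos hex, h1, h2]

lemma excludedDiff_eq_zero {s : ℕ} {g : ℕ → α} (h : ∀ a ℓ, ¬ CentralPeriod s g a ℓ) :
    excludedDiff s g = 0 := by
  rw [excludedDiff, dif_neg]
  rintro ⟨p, hp⟩
  exact h _ _ hp

lemma excludedDiff_congr {s : ℕ} {g g' : ℕ → α} (h : ∀ i < 2 * s, i ≠ s → g i = g' i) :
    excludedDiff s g = excludedDiff s g' := by
  by_cases hex : ∃ a ℓ, CentralPeriod s g a ℓ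
  · obtain ⟨a, ℓ, hg⟩ := hex
    rw [excludedDiff_eq hg, excludedDiff_eq (hg.congr h)]
    obtain ⟨h1, h2, -⟩ := hg
    rw [h _ (by omega) (by omega)]
  · push Not at hex
    rw [excludedDiff_eq_zero hex, excludedDiff_eq_zero]
    intro a ℓ hg
    exact hex a ℓ (hg.congr fun i hi his => (h i hi his).symm)

lemma InCode.congr {s : ℕ} {g g' : ℕ → α} (h : ∀ i < 2 * s + 1, g i = g' i)
    (hs : 1 ≤ s) (hg : InCode s g) : InCode s g' := by
  rcases hg with hg | hg
  · left
    rwa [← excludedDiff_congr (g := g) fun i hi _ => h i (by omega), ← h _ (by omega),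
      ← h _ (by omega)]
  · right
    intro i hi
    rw [← h _ (by omega), ← h _ (by omega), hg i hi]

/-- Words that agree except in the central and last positions are not both excluded, unless
they have the same difference. -/
lemma inCode_of_sub_ne {s : ℕ} {x y : ℕ → α} (h : ∀ i < 2 * s, i ≠ s → x i = y i)
    (hx : x (2 * s) - x s = excludedDiff s x) (hne : x (2 * s) - x s ≠ y (2 * s) - y s) :
    InCode s y := by
  left
  rw [← excludedDiff_congr h, ← hx]
  exact hne.symm

lemma sub_eq_excludedDiff_of_repeatsOn {s q : ℕ} {x : ℕ → α} (hq : 1 ≤ q) (hqs : q < s)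
    (h : RepeatsOn x (s + 1 - q) (2 * s + 1) q) :
    x (2 * s) - x s = excludedDiff s x := by
  classical
  have hex : ∃ k, 1 ≤ k ∧ RepeatsOn x (s + 1 - k) (2 * s) k :=
    ⟨q, hq, fun i hi hi' => h i hi (by omega)⟩
  obtain ⟨k, ⟨hk1, hk⟩, hmin⟩ : ∃ k, (1 ≤ k ∧ RepeatsOn x (s + 1 - k) (2 * s) k) ∧
      ∀ m < k, ¬ (1 ≤ m ∧ RepeatsOn x (s + 1 - m) (2 * s) m) :=
    ⟨Nat.find hex, Nat.find_spec hex, fun m hm => Nat.find_min hex hm⟩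
  have hkq : k ≤ q := by
    by_contra hlt
    exact hmin q (by omega) ⟨hq, fun i hi hi' => h i hi (by omega)⟩
  have hc : CentralPeriod s x (x s) k := by
    refine ⟨hk1, by omega, ?_, ?_⟩
    · rwa [Function.update_eq_self]
    · rw [Function.update_eq_self]
      intro m hm hmk hr
      exact hmin m hmk ⟨hm, fun i hi hi' => hr i (by omega) hi'⟩
  rw [excludedDiff_eq hc]
  congr 1
  have e₁ := h (2 * s - q) (by omega) (by omega)
  have e₂ := hk (2 * s - q - k) (by omega) (by omega)
  have e₃ := h (2 * s - q - k) (by omega) (by omega)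
  rw [show 2 * s - q + q = 2 * s by omega] at e₁
  rw [show 2 * s - q - k + k = 2 * s - q by omega] at e₂
  rw [show 2 * s - q - k + q = 2 * s - k by omega] at e₃
  rw [← e₁, ← e₂, e₃]

lemma excludedDiff_eq_zero_of_repeatsOn {s : ℕ} {x : ℕ → α}
    (h : ∀ i, 2 ≤ i → i < s → x i = x (i + s)) : excludedDiff s x = 0 := by
  by_cases hex : ∃ a ℓ, CentralPeriod s x a ℓ
  · obtain ⟨a, ℓ, hc⟩ := hex
    rw [excludedDiff_eq hc, sub_eq_zero]
    obtain ⟨h1, h2, h3, -⟩ := hc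
    have := eq_of_two_periods (Function.update (Function.update x s a) (2 * s) (x (2 * s - ℓ)))
      (s + 1 - ℓ) (ℓ - 1) s ?_ ?_
    · rw [show s + 1 - ℓ + (ℓ - 1) = s by omega, ← two_mul, Function.update_self,
        Function.update_of_ne (by omega), Function.update_self] at this
      exact this
    · intro k hk
      iterate 4 rw [Function.update_of_ne (by omega)]
      exact (h _ (by omega) (by omega)).symm
    · intro k hk
      rw [Function.update_of_ne (by omega)]
      by_cases hk' : k + 1 = s
      · rw [show s + 1 - ℓ + (ℓ - 1 + 1) + k = 2 * s by omega, Function.update_self,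
          Function.update_of_ne (by omega)]
        congr 1
        omega
      · rw [Function.update_of_ne (a := s + 1 - ℓ + (ℓ - 1 + 1) + k) (by omega),
          h3 (s + 1 - ℓ + k) (by omega) (by omega)]
        congr 1
        omega
  · push Not at hex
    exact excludedDiff_eq_zero hex

lemma inCode_of_period {s j q : ℕ} {g h : ℕ → α} {b : α} (hs : 2 ≤ s) (hj : j ≤ s)
    (hgh : ∀ i < 2 * s - j, g i = h i) (hne : g (2 * s - j) ≠ h (2 * s - j))
    (hq : 1 ≤ q) (hqj : q + j ≤ s + 1)
    (hg : ∀ k, k + q ≤ 2 * s - j → g (k + q) = g k) :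
    InCode s (padLeft j b h) := by
  have G : ∀ k m, m = k + q → m ≤ 2 * s - j → g m = g k := fun k m e hm => e ▸ hg k (e ▸ hm)
  rcases lt_trichotomy q s with hqs | rfl | hqs
  · refine inCode_of_sub_ne (x := padLeft j b g) ?_
      (sub_eq_excludedDiff_of_repeatsOn hq hqs ?_) ?_
    · exact fun i hi _ => padLeft_congr b hgh hi
    · intro i hi hi'
      rw [padLeft_of_le _ _ (by omega), padLeft_of_le _ _ (by omega)]
      exact (G _ _ (by omega) (by omega)).symm
    · rw [padLeft_of_le _ _ (by omega), padLeft_of_le _ _ (by omega), padLeft_of_le _ _ (by omega), padLeft_of_le _ _ (by omega),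
        hgh (s - j) (by omega)]
      exact fun e => hne (sub_left_injective e)
  · left
    rw [excludedDiff_eq_zero_of_repeatsOn]
    · rw [padLeft_of_le _ _ (by omega), padLeft_of_le _ _ (by omega), ← hgh (q - j) (by omega), sub_ne_zero,
        ← G (q - j) (2 * q - j) (by omega) le_rfl]
      exact hne.symm
    · intro i hi hi'
      rw [padLeft_of_le _ _ (by omega), padLeft_of_le _ _ (by omega), ← hgh _ (by omega), ← hgh _ (by omega)]
      exact (G _ _ (by omega) (by omega)).symm
  · right
    intro i hi
    obtain rfl : j = 0 := by omega
    rw [padLeft_of_le _ _ (by omega), padLeft_of_le _ _ (by omega), Nat.sub_zero, Nat.sub_zero, ← hgh _ (by omega), ← hgh _ (by omega)]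
    exact (G _ _ (by omega) (by omega)).symm

lemma exists_separating_of_long_prefix [Nontrivial α] {s j : ℕ} {g h : ℕ → α} (hs : 2 ≤ s)
    (hj : j ≤ s) (hgh : ∀ i < 2 * s - j, g i = h i) (hne : g (2 * s - j) ≠ h (2 * s - j)) :
    ∃ x, InCode s x ∧ ¬ (Reaches s x g ↔ Reaches s x h) := by
  obtain ⟨b, hb⟩ := exists_ne (h 0)
  have hb' : b ≠ g 0 := by rwa [hgh 0 (by omega)]
  have self : ∀ f : ℕ → α, Reaches s (padLeft j b f) f :=
    fun f => ⟨j, by omega, fun i _ => padLeft_add ..⟩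
  have hhg : ∀ i < 2 * s - j, h i = g i := fun i hi => (hgh i hi).symm
  by_cases hrg : Reaches s (padLeft j b g) h
  · obtain ⟨q, hq, hqj, hper⟩ := exists_period_of_reaches hj hgh hne hb hrg
    refine ⟨_, inCode_of_period (b := b) hs hj hgh hne hq hqj hper, fun hiff => ?_⟩
    obtain ⟨q', hq', hqj', hper'⟩ := exists_period_of_reaches hj hhg hne.symm hb'
      (hiff.2 (self h))
    exact not_two_periods (by omega) hj hgh hne hq hq' hqj hqj' hper hper'
  · by_cases hrh : Reaches s (padLeft j b h) g
    · obtain ⟨q, hq, hqj, hper⟩ := exists_period_of_reaches hj hhg hne.symm hb' hrh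
      exact ⟨_, inCode_of_period (b := b) hs hj hhg hne.symm hq hqj hper,
        fun hiff => hrg (hiff.1 (self g))⟩
    · by_cases hS : InCode s (padLeft j b g)
      · exact ⟨_, hS, fun hiff => hrg (hiff.1 (self g))⟩
      · refine ⟨padLeft j b h, ?_, fun hiff => hrh (hiff.2 (self h))⟩
        rw [InCode, not_or, not_not] at hS
        refine inCode_of_sub_ne ?_ hS.1 ?_
        · exact fun i hi _ => padLeft_congr b hgh hi
        · rw [padLeft_of_le _ _ (by omega), padLeft_of_le _ _ (by omega), padLeft_of_le _ _ (by omega), padLeft_of_le _ _ (by omega),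
            hgh (s - j) (by omega)]
          exact fun e => hne (sub_left_injective e)

lemma exists_separating_or_shift [Nontrivial α] {s : ℕ} {g h : ℕ → α} (hs : 2 ≤ s)
    (hgh : ∃ i < s, g i ≠ h i) :
    (∃ x, InCode s x ∧ ¬ (Reaches s x g ↔ Reaches s x h)) ∨ ∀ i < s, g i = h (i + 1) := by
  obtain ⟨b, hb⟩ := exists_ne (h 0)
  by_cases hS : InCode s (padLeft (s + 1) b g)
  · refine Or.inl ⟨_, hS, fun hiff => not_reaches_of_prefix_ne hgh hb (hiff.1 ?_)⟩
    exact ⟨s + 1, le_rfl, fun i _ => padLeft_add ..⟩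
  · rw [InCode, not_or, not_not] at hS
    set y : ℕ → α :=
      Function.update (padLeft (s + 1) b g) s (h 0) with hy
    have hyS : InCode s y := by
      refine inCode_of_sub_ne ?_ hS.1 ?_
      · intro i _ his
        rw [hy, Function.update_of_ne his]
      · rw [hy, Function.update_self, Function.update_of_ne (by omega), padLeft_of_lt (i := s) _ _ (by omega)]
        exact fun e => hb (by simpa using e)
    have hyg : Reaches s y g := by
      refine ⟨s + 1, le_rfl, fun i _ => ?_⟩
      rw [hy, Function.update_of_ne (by omega), padLeft_add]
    by_cases hyh : Reaches s y h
    · right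
      obtain ⟨j, hj, hr⟩ := hyh
      have : j = s ∨ j = s + 1 ∨ j < s := by omega
      rcases this with rfl | rfl | hj'
      · intro i hi
        rw [← hr (i + 1) (by omega), hy, Function.update_of_ne (by omega), padLeft_of_le _ _ (by omega)]
        congr 1
        omega
      · obtain ⟨i, hi, hne⟩ := hgh
        have := hr i (by omega)
        rw [hy, Function.update_of_ne (by omega), padLeft_add] at this
        exact absurd this hne
      · have := hr 0 (by omega)
        rw [hy, Function.update_of_ne (by omega), padLeft_of_lt _ _ (by omega)] at this
        exact absurd this hb
    · exact Or.inl ⟨y, hyS, fun hiff => hyh (hiff.1 hyg)⟩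

lemma exists_separating_of_prefix_ne [Nontrivial α] {s : ℕ} {g h : ℕ → α} (hs : 2 ≤ s)
    (hgh : ∃ i < s, g i ≠ h i) :
    ∃ x, InCode s x ∧ ¬ (Reaches s x g ↔ Reaches s x h) := by
  rcases exists_separating_or_shift hs hgh with hx | e₁
  · exact hx
  rcases exists_separating_or_shift hs
    (show ∃ i < s, h i ≠ g i from hgh.imp fun i hi => ⟨hi.1, hi.2.symm⟩) with hx | e₂
  · exact hx.imp fun x hx => ⟨hx.1, fun hiff => hx.2 hiff.symm⟩
  have h0 : g 0 ≠ h 0 := by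
    intro h0
    have : ∀ i ≤ s, g i = h i := by
      intro i
      induction i with
      | zero => exact fun _ => h0
      | succ i ih =>
        intro hi
        rw [← e₁ i (by omega), ← e₂ i (by omega), ih (by omega)]
    obtain ⟨i, hi, hne⟩ := hgh
    exact hne (this i hi.le)
  refine ⟨padLeft (s + 1) (g 0) g, ?_,
    fun hiff => not_reaches_of_prefix_ne hgh h0 (hiff.1 ⟨s + 1, le_rfl, fun i _ => padLeft_add ..⟩)⟩
  rcases hs.eq_or_lt with rfl | hs
  · left
    rw [excludedDiff_eq_zero_of_repeatsOn (fun i h1 h2 => by omega)]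
    rw [padLeft_of_le _ _ (by omega), padLeft_of_lt _ _ (by omega), sub_ne_zero,
      show 2 * 2 - (2 + 1) = 0 + 1 by omega, ← e₂ 0 (by omega)]
    exact h0.symm
  · refine inCode_of_sub_ne
      (x := Function.update (padLeft (s + 1) (g 0) g) s (h 0))
      ?_ (sub_eq_excludedDiff_of_repeatsOn (q := 2) (by omega) hs ?_) ?_
    · intro i _ his
      rw [Function.update_of_ne his]
    · intro i hi hi'
      rw [Function.update_of_ne (a := i + 2) (by omega), padLeft_of_le _ _ (by omega)]
      have : i = s - 1 ∨ i = s ∨ s < i := by omega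
      rcases this with rfl | rfl | hlt
      · rw [Function.update_of_ne (by omega), padLeft_of_lt _ _ (by omega)]
        congr 1
        omega
      · rw [Function.update_self, show i + 2 - (i + 1) = 0 + 1 by omega, e₂ 0 (by omega)]
      · rw [Function.update_of_ne (by omega), padLeft_of_le _ _ (by omega), e₁ _ (by omega),
          e₂ _ (by omega)]
        congr 1
        omega
    · rw [Function.update_self, Function.update_of_ne (by omega), padLeft_of_lt (i := s) _ _ (by omega)]
      exact fun e => h0 (by simpa using e.symm)

/-- Distinct words of length `2 * s + 1` are separated by a codeword. -/
lemma exists_separating [Nontrivial α] {s : ℕ} {g h : ℕ → α} (hs : 2 ≤ s)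
    (hgh : ∃ i < 2 * s + 1, g i ≠ h i) :
    ∃ x, InCode s x ∧ ¬ (Reaches s x g ↔ Reaches s x h) := by
  classical
  by_cases hc : ∃ i < s, g i ≠ h i
  · exact exists_separating_of_prefix_ne hs hc
  · push Not at hc
    have hp := Nat.find_spec hgh
    have hmin := fun m => Nat.find_min hgh (m := m)
    set p := Nat.find hgh
    have hsp : s ≤ p := by
      by_contra hlt
      exact hp.2 (hc p (by omega))
    refine exists_separating_of_long_prefix (j := 2 * s - p) hs (by omega) ?_ ?_
    · intro i hi
      by_contra hne
      exact hmin i (by omega) ⟨by omega, hne⟩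
    · rw [show 2 * s - (2 * s - p) = p by omega]
      exact hp.2

/-- Every ball contains a codeword. -/
lemma exists_inCode_reaches (s : ℕ) (g : ℕ → α) : ∃ x, InCode s x ∧ Reaches s x g := by
  refine ⟨fun i => g (i % (s + 1)), Or.inr fun i hi => ?_, s + 1, le_rfl, fun i hi => ?_⟩
  · simp [add_assoc]
  · simp [Nat.mod_eq_of_lt (show i < s + 1 by omega)]

end Words

/-- For every prefix of length `s` there is a last letter making the word of length `s + 1`
primitive. -/
lemma exists_letter_primitive {α : Type*} [Nontrivial α] (s : ℕ) (g : ℕ → α) :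
    ∃ a, ∀ k, 1 ≤ k → k < s + 1 →
      ¬ RepeatsOn (fun i => Function.update g s a (i % (s + 1))) 0 (2 * (s + 1)) k := by
  obtain ⟨a, b, hab⟩ := exists_pair_ne α
  by_contra! hcon
  obtain ⟨p, hp, hps, ha⟩ := hcon a
  obtain ⟨q, hq, hqs, hb⟩ := hcon b
  have extend : ∀ c k, k < s + 1 →
      RepeatsOn (fun i => Function.update g s c (i % (s + 1))) 0 (2 * (s + 1)) k →
      ∀ i, Function.update g s c (i % (s + 1)) = Function.update g s c ((i + k) % (s + 1)) := by
    intro c k hk hr i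
    have hlt : i % (s + 1) < s + 1 := Nat.mod_lt i (by omega)
    have := hr (i % (s + 1)) (Nat.zero_le _) (by omega)
    simpa using this
  have ea := extend a p hps ha
  have eb := extend b q hqs hb
  have off : ∀ i, i % (s + 1) ≠ s →
      Function.update g s a (i % (s + 1)) = Function.update g s b (i % (s + 1)) := by
    intro i hi
    rw [Function.update_of_ne hi, Function.update_of_ne hi]
  have shift : ∀ k, 1 ≤ k → k < s + 1 → (s + k) % (s + 1) ≠ s := by
    intro k hk hks
    rw [show s + k = k - 1 + (s + 1) by omega, Nat.add_mod_right,
      Nat.mod_eq_of_lt (by omega)]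
    omega
  have center : s % (s + 1) = s := Nat.mod_eq_of_lt (by omega)
  have h1 : a = Function.update g s b ((s + p + q) % (s + 1)) := by
    rw [← eb, ← off _ (shift p hp hps), ← ea, center, Function.update_self]
  apply hab
  by_cases hpq : p + q = s + 1
  · rwa [show s + p + q = s + (s + 1) by omega, Nat.add_mod_right, center,
      Function.update_self] at h1
  · have hne : (s + p + q) % (s + 1) ≠ s := by
      intro e
      have := Nat.div_add_mod (s + p + q) (s + 1)
      rw [e] at this
      have hd : (s + p + q) / (s + 1) < 3 := by
        rw [Nat.div_lt_iff_lt_mul (by omega)]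
        omega
      interval_cases (s + p + q) / (s + 1) <;> omega
    rw [h1, ← off _ hne, show s + p + q = s + q + p by ring, ← ea, off _ (shift q hq hqs), ← eb,
      center, Function.update_self]

/-- The letters of a string, as a function on `ℕ` with value `0` beyond the end. -/
def letters {d n : ℕ} [NeZero d] (x : Vtx d n) : ℕ → Fin d :=
  fun i => if h : i < n then x ⟨i, h⟩ else 0

/-- The string formed by the first `n` letters of `g`. -/
def ofLetters {d : ℕ} (n : ℕ) (g : ℕ → Fin d) : Vtx d n := fun i => g i

section Strings

variable {d : ℕ}

lemma letters_of_lt [NeZero d] {n i : ℕ} (x : Vtx d n) (h : i < n) : letters x i = x ⟨i, h⟩ :=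
  dif_pos h

lemma letters_ofLetters [NeZero d] {n i : ℕ} (g : ℕ → Fin d) (h : i < n) :
    letters (ofLetters n g) i = g i :=
  letters_of_lt _ h

lemma hasPeriod_iff {N lo ℓ : ℕ} {w : Fin N → Fin d} {f : ℕ → Fin d}
    (hw : ∀ i : Fin N, w i = f (lo + i)) :
    HasPeriod w ℓ ↔ 2 * ℓ ≤ N ∧ RepeatsOn f lo (lo + N) ℓ := by
  refine and_congr_right fun _ => ⟨fun h i hi hi' => ?_, fun h i hi => ?_⟩
  · have := h (i - lo) (by omega)
    rw [hw, hw] at this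
    dsimp only at this
    rwa [show lo + (i - lo) = i by omega, show lo + (i - lo + ℓ) = i + ℓ by omega] at this
  · rw [hw, hw]
    have := h (lo + i) (by omega) (by omega)
    rwa [add_assoc] at this

lemma isPeriodic_iff {N lo ℓ : ℕ} {w : Fin N → Fin d} {f : ℕ → Fin d}
    (hw : ∀ i : Fin N, w i = f (lo + i)) (hℓ : 2 * ℓ ≤ N) :
    IsPeriodic w ℓ ↔ RepeatsOn f lo (lo + N) ℓ ∧
      ∀ k, 1 ≤ k → k < ℓ → ¬ RepeatsOn f lo (lo + N) k := by
  simp only [IsPeriodic, hasPeriod_iff hw, hℓ, true_and]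
  refine and_congr_right fun _ => forall_congr' fun k => forall_congr' fun _ =>
    forall_congr' fun hk => ?_
  rw [and_iff_right (by omega)]

lemma isPeriodic_snoc_iff {N ℓ : ℕ} {w : Fin N → Fin d} (hℓ : 1 ≤ ℓ) (hℓN : ℓ ≤ N)
    (hw : IsPeriodic w ℓ) (c : Fin d) :
    IsPeriodic (Fin.snoc w c : Fin (N + 1) → Fin d) ℓ ↔ c = w ⟨N - ℓ, by omega⟩ := by
  have low : ∀ (i : ℕ) (hi : i < N),
      (Fin.snoc w c : Fin (N + 1) → Fin d) ⟨i, by omega⟩ = w ⟨i, hi⟩ :=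
    fun i hi => Fin.snoc_castSucc (α := fun _ => Fin d) c w ⟨i, hi⟩
  have last : (Fin.snoc w c : Fin (N + 1) → Fin d) ⟨N, by omega⟩ = c :=
    Fin.snoc_last (α := fun _ => Fin d) c w
  constructor
  · intro h
    have := h.1.2 (N - ℓ) (by omega)
    rw [low _ (by omega)] at this
    simp only [Nat.sub_add_cancel hℓN, last] at this
    exact this.symm
  · intro hc
    have h2 := hw.1.1
    refine ⟨⟨by omega, fun i hi => ?_⟩, fun k hk hkℓ h => hw.2 k hk hkℓ ⟨by omega, fun i hi => ?_⟩⟩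
    · rw [low i (by omega)]
      rcases Nat.lt_or_ge (i + ℓ) N with hlt | hge
      · rw [low _ hlt]
        exact hw.1.2 i hlt
      · obtain rfl : i = N - ℓ := by omega
        simp only [Nat.sub_add_cancel hℓN, last]
        exact hc.symm
    · have := h.2 i (by omega)
      rwa [low i (by omega), low _ hi] at this

variable [NeZero d]

lemma modify_apply {s k : ℕ} (x : Vtx d (2 * s + 1)) (m : Fin d) (hk : k < 2 * s + 1) :
    modify x s m ⟨k, hk⟩ = Function.update (letters x) s (letters x s + m) k := by
  rw [modify]
  by_cases h : k = s
  · subst h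
    rw [if_pos rfl, Function.update_self, letters_of_lt _ hk]
  · rw [if_neg h, Function.update_of_ne h, letters_of_lt _ hk]

lemma isPeriodic_substr_iff {s ℓ : ℕ} (x : Vtx d (2 * s + 1)) (m : Fin d) (hℓ : 1 ≤ ℓ)
    (hℓs : ℓ < s) (h₁ : 1 ≤ s + 1 + 1 - ℓ) (h₂ : 2 * s ≤ 2 * s + 1) :
    IsPeriodic (substr (modify x s m) (s + 1 + 1 - ℓ) (2 * s) h₁ h₂) ℓ ↔
      CentralPeriod s (letters x) (letters x s + m) ℓ := by
  rw [isPeriodic_iff (lo := s + 1 - ℓ)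
    (f := Function.update (letters x) s (letters x s + m)) _ (by omega), CentralPeriod,
    show s + 1 - ℓ + (2 * s + 1 - (s + 1 + 1 - ℓ)) = 2 * s by omega]
  · simp [hℓ, hℓs]
  · intro i
    rw [substr, modify_apply]
    congr 1
    omega

lemma exists_almostPeriodic_iff {s : ℕ} (hd : 2 ≤ d) (x : Vtx d (2 * s + 1)) (h₁ : 1 ≤ 1)
    (h₂ : 2 * s ≤ 2 * s + 1) :
    (∃ m : Fin d, AlmostPeriodic (substr (modify x s m) 1 (2 * s) h₁ h₂) (s + 1)) ↔
      ∀ i, i + 1 < s → letters x i = letters x (i + s + 1) := by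
  have hsub : ∀ (m : Fin d) (i : Fin (2 * s + 1 - 1)),
      substr (modify x s m) 1 (2 * s) h₁ h₂ i =
        Function.update (letters x) s (letters x s + m) i := by
    intro m i
    rw [substr, modify_apply]
    congr 1
    omega
  constructor
  · rintro ⟨m, -, w', ⟨-, hp⟩, -⟩ i hi
    have e₁ := Fin.append_left (substr (modify x s m) 1 (2 * s) h₁ h₂) w' ⟨i, by omega⟩
    have e₂ := Fin.append_left (substr (modify x s m) 1 (2 * s) h₁ h₂) w'
      ⟨i + (s + 1), by omega⟩
    have := (e₁.symm.trans (hp i (by omega))).trans e₂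
    rwa [hsub, hsub, Function.update_of_ne (by dsimp only; omega),
      Function.update_of_ne (by dsimp only; omega)] at this
  · intro h
    have : Nontrivial (Fin d) := Fin.nontrivial_iff_two_le.2 hd
    obtain ⟨a, ha⟩ := exists_letter_primitive s (letters x)
    set f : ℕ → Fin d := fun i => Function.update (letters x) s a (i % (s + 1)) with hf
    refine ⟨a - letters x s, by omega, fun i => f (2 * s + 1 - 1 + i), ?_⟩
    have hlen : 0 + (2 * s + 1 - 1 + (2 * (s + 1) - (2 * s + 1 - 1))) = 2 * (s + 1) := by omega
    rw [isPeriodic_iff (lo := 0) (f := f) _ (by omega), hlen]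
    · refine ⟨fun i _ _ => ?_, ha⟩
      simp [hf]
    · intro i
      rw [Nat.zero_add]
      refine Fin.addCases (fun i => ?_) (fun i => ?_) i
      · rw [Fin.append_left, hsub, hf, Fin.val_castAdd, add_sub_cancel]
        dsimp only
        have hi := i.isLt
        rcases lt_or_ge (i : ℕ) (s + 1) with hlt | hge
        · rw [Nat.mod_eq_of_lt hlt]
        · rw [Nat.mod_eq_sub_mod hge, Nat.mod_eq_of_lt (by omega),
            Function.update_of_ne (by omega), Function.update_of_ne (by omega),
            h (i - (s + 1)) (by omega)]
          congr 1
          omega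
      · rw [Fin.append_right, Fin.val_natAdd]

/-- The three conditions that define the code amount to `InCode`. -/
lemma code_conditions_iff {s : ℕ} (hd : 2 ≤ d) (x : Vtx d (2 * s + 1))
    (h₁ : ∀ ℓ, ℓ < s → 1 ≤ s + 1 + 1 - ℓ) (h₂ : 2 * s ≤ 2 * s + 1) (h₃ : 1 ≤ 1) :
    ((∃ m : Fin d, ∃ ℓ : ℕ, ∃ _ : 1 ≤ ℓ, ∃ hℓ : ℓ < s,
        IsPeriodic (substr (modify x s m) (s + 1 + 1 - ℓ) (2 * s) (h₁ ℓ hℓ) h₂) ℓ ∧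
        ¬ IsPeriodic (Fin.snoc (substr (modify x s m) (s + 1 + 1 - ℓ) (2 * s) (h₁ ℓ hℓ) h₂)
          (x ⟨2 * s, by omega⟩ + m)) ℓ) ∨
      (x ⟨s, by omega⟩ ≠ x ⟨2 * s, by omega⟩ ∧
        ∀ m : Fin d, ∀ ℓ : ℕ, 1 ≤ ℓ → ∀ hℓ : ℓ < s,
          ¬ IsPeriodic (substr (modify x s m) (s + 1 + 1 - ℓ) (2 * s) (h₁ ℓ hℓ) h₂) ℓ) ∨
      (∃ m : Fin d, AlmostPeriodic (substr (modify x s m) 1 (2 * s) h₃ h₂) (s + 1))) ↔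
    InCode s (letters x) := by
  rw [exists_almostPeriodic_iff hd, InCode, ← or_assoc]
  refine or_congr_left ?_
  have hlast : letters x (2 * s) = x ⟨2 * s, by omega⟩ := letters_of_lt _ _
  have hmid : letters x s = x ⟨s, by omega⟩ := letters_of_lt _ _
  have first : ∀ (m : Fin d) (ℓ : ℕ) (hℓ : 1 ≤ ℓ) (hℓs : ℓ < s),
      CentralPeriod s (letters x) (letters x s + m) ℓ →
      (IsPeriodic (Fin.snoc (substr (modify x s m) (s + 1 + 1 - ℓ) (2 * s) (h₁ ℓ hℓs) h₂)
          (x ⟨2 * s, by omega⟩ + m) : Fin (2 * s + 1 - (s + 1 + 1 - ℓ) + 1) → Fin d) ℓ ↔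
        letters x (2 * s) - letters x s = excludedDiff s (letters x)) := by
    intro m ℓ hℓ hℓs hc
    rw [isPeriodic_snoc_iff hℓ (by omega)
      ((isPeriodic_substr_iff x m hℓ hℓs (h₁ ℓ hℓs) h₂).2 hc), excludedDiff_eq hc, substr,
      modify_apply, ← hlast, Function.update_of_ne (by dsimp only; omega),
      sub_eq_sub_iff_add_eq_add]
    dsimp only
    rw [show s + 1 + 1 - ℓ - 1 + (2 * s + 1 - (s + 1 + 1 - ℓ) - ℓ) = 2 * s - ℓ by omega,
      add_left_comm, add_comm (letters x (2 * s - ℓ)), add_right_inj]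
  by_cases hex : ∃ a ℓ, CentralPeriod s (letters x) a ℓ
  · obtain ⟨a, ℓ, hc⟩ := hex
    obtain ⟨m, rfl⟩ : ∃ m, a = letters x s + m := ⟨a - letters x s, by abel⟩
    have hℓ := hc.1
    have hℓs := hc.2.1
    constructor
    · rintro (⟨m', ℓ', hℓ', hℓs', hp, hnp⟩ | ⟨-, hno⟩)
      · rw [isPeriodic_substr_iff x m' hℓ' hℓs'] at hp
        rwa [first m' ℓ' hℓ' hℓs' hp] at hnp
      · exact absurd ((isPeriodic_substr_iff x m hℓ hℓs _ h₂).2 hc) (hno m ℓ hℓ hℓs)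
    · intro hne
      exact Or.inl ⟨m, ℓ, hℓ, hℓs, (isPeriodic_substr_iff x m hℓ hℓs _ h₂).2 hc,
        fun hp => hne ((first m ℓ hℓ hℓs hc).1 hp)⟩
  · push Not at hex
    rw [excludedDiff_eq_zero hex, sub_ne_zero, hlast, hmid]
    constructor
    · rintro (⟨m', ℓ', hℓ', hℓs', hp, -⟩ | ⟨hne, -⟩)
      · exact absurd ((isPeriodic_substr_iff x m' hℓ' hℓs' _ h₂).1 hp) (hex _ _)
      · exact hne.symm
    · intro hne
      exact Or.inr ⟨hne.symm, fun m ℓ hℓ hℓs hp =>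
        hex _ _ ((isPeriodic_substr_iff x m hℓ hℓs _ h₂).1 hp)⟩

lemma hasWalk_iff {n j : ℕ} (x y : Vtx d n) :
    hasWalk d n j x y ↔ ∀ i, i + j < n → letters x (i + j) = letters y i := by
  constructor
  · rintro ⟨f, rfl, rfl, hf⟩
    have step : ∀ k ≤ j, ∀ i, i + k < n → letters (f 0) (i + k) = letters (f k) i := by
      intro k
      induction k with
      | zero => simp
      | succ k ih =>
        intro hk i hi
        rw [show i + (k + 1) = i + 1 + k by ring, ih (by omega) (i + 1) (by omega),
          letters_of_lt _ (by omega : i + 1 < n), letters_of_lt _ (by omega : i < n)]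
        exact hf k (by omega) i (by omega)
    exact step j le_rfl
  · intro h
    refine ⟨fun k => ofLetters n fun i =>
      if i + k < n then letters x (i + k) else letters y (i + k - j), ?_, ?_, ?_⟩
    · funext i
      simp [ofLetters, letters_of_lt x i.isLt]
    · funext i
      simp only [ofLetters, Nat.add_sub_cancel]
      split_ifs with hi
      · rw [h _ hi, letters_of_lt _ i.isLt]
      · rw [letters_of_lt _ i.isLt]
    · intro k _ i hi
      simp only [ofLetters, add_right_comm, add_assoc]

lemma mem_inBall_iff {s : ℕ} (x v : Vtx d (2 * s + 1)) :
    x ∈ inBall d (2 * s + 1) (s + 1) v ↔ Reaches s (letters x) (letters v) := by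
  have hne : {t : ℕ | hasWalk d (2 * s + 1) t x v}.Nonempty :=
    ⟨2 * s + 1, (hasWalk_iff x v).2 fun i hi => by omega⟩
  simp only [Reaches, ← hasWalk_iff]
  constructor
  · intro h
    exact ⟨_, h, Nat.sInf_mem hne⟩
  · rintro ⟨j, hj, hw⟩
    exact (Nat.sInf_le (s := {t : ℕ | hasWalk d (2 * s + 1) t x v}) hw).trans hj

lemma isIdCode_inCode {s : ℕ} (hd : 2 ≤ d) (hs : 2 ≤ s) :
    IsIdCode d (2 * s + 1) (s + 1) {x | InCode s (letters x)} := by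
  have : Nontrivial (Fin d) := Fin.nontrivial_iff_two_le.2 hd
  have code : ∀ g : ℕ → Fin d, InCode s g → InCode s (letters (ofLetters (2 * s + 1) g)) :=
    fun g hg => hg.congr (fun i hi => (letters_ofLetters g hi).symm) (by omega)
  have ball : ∀ (g : ℕ → Fin d) (v : Vtx d (2 * s + 1)),
      ofLetters (2 * s + 1) g ∈ inBall d (2 * s + 1) (s + 1) v ↔ Reaches s g (letters v) := by
    intro g v
    rw [mem_inBall_iff]
    refine exists_congr fun j => and_congr_right fun _ => forall_congr' fun i =>
      forall_congr' fun hi => ?_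
    rw [letters_ofLetters g hi]
  refine ⟨fun v => ?_, fun u v huv heq => ?_⟩
  · obtain ⟨g, hg, hr⟩ := exists_inCode_reaches s (letters v)
    exact ⟨ofLetters _ g, (ball g v).2 hr, code g hg⟩
  · obtain ⟨g, hg, hr⟩ := exists_separating (g := letters u) (h := letters v) hs (by
      obtain ⟨i, hi⟩ := Function.ne_iff.1 huv
      exact ⟨i, i.isLt, by rwa [letters_of_lt _ i.isLt, letters_of_lt _ i.isLt]⟩)
    apply hr
    have := Set.ext_iff.1 heq (ofLetters _ g)
    simpa [ball, code g hg] using this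

/-- The strings of length `2 * s + 1` with `x (2 * s) - x s` different from the excluded
difference are parametrized by their first `2 * s` letters and a nonzero letter. -/
lemma ncard_not_excluded (s : ℕ) (hs : 1 ≤ s) :
    {x : Vtx d (2 * s + 1) | letters x (2 * s) - letters x s ≠
      excludedDiff s (letters x)}.ncard = d ^ (2 * s) * (d - 1) := by
  set φ : Vtx d (2 * s) × {c : Fin d // c ≠ 0} → Vtx d (2 * s + 1) := fun p =>
    ofLetters _ (Function.update (letters p.1) (2 * s)
      (p.2 + letters p.1 s + excludedDiff s (letters p.1))) with hφ
  have low : ∀ p, ∀ i < 2 * s, letters (φ p) i = letters p.1 i := by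
    intro p i hi
    rw [hφ, letters_ofLetters _ (by omega), Function.update_of_ne (by omega)]
  have high : ∀ p, letters (φ p) (2 * s) =
      p.2 + letters p.1 s + excludedDiff s (letters p.1) := by
    intro p
    rw [hφ, letters_ofLetters _ (by omega), Function.update_self]
  have hinj : Function.Injective φ := by
    intro p p' h
    have h1 : p.1 = p'.1 := by
      funext i
      rw [← letters_of_lt p.1 i.isLt, ← letters_of_lt p'.1 i.isLt, ← low p i i.isLt, h,
        low p' i i.isLt]
    have h2 := high p
    rw [h, high p', h1, add_left_inj, add_left_inj] at h2
    exact Prod.ext h1 (Subtype.ext h2.symm)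
  have hrange : {x : Vtx d (2 * s + 1) | letters x (2 * s) - letters x s ≠
      excludedDiff s (letters x)} = Set.range φ := by
    ext x
    constructor
    · intro hx
      have hw : ∀ i < 2 * s, letters (ofLetters (2 * s) (letters x)) i = letters x i :=
        fun i hi => letters_ofLetters _ hi
      refine ⟨(ofLetters (2 * s) (letters x),
        ⟨letters x (2 * s) - letters x s - excludedDiff s (letters x), sub_ne_zero.2 hx⟩), ?_⟩
      funext i
      rw [← letters_of_lt (φ _) i.isLt, ← letters_of_lt x i.isLt]
      rcases Nat.lt_succ_iff_lt_or_eq.1 i.isLt with hi | hi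
      · rw [low _ _ hi, hw _ hi]
      · rw [hi, high]
        dsimp only
        rw [hw s (by omega), excludedDiff_congr fun i hi _ => hw i hi]
        abel
    · rintro ⟨p, rfl⟩
      rw [Set.mem_ofPred_eq, high, low p s (by omega), excludedDiff_congr fun i hi _ => low p i hi]
      intro e
      apply p.2.2
      have : (p.2 : Fin d) + letters p.1 s + excludedDiff s (letters p.1) - letters p.1 s =
          p.2 + excludedDiff s (letters p.1) := by abel
      rw [this] at e
      simpa using e
  rw [hrange, ← Set.image_univ, Set.ncard_image_of_injective _ hinj, Set.ncard_univ,
    Nat.card_prod, Nat.card_eq_fintype_card, Nat.card_eq_fintype_card,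
    Fintype.card_subtype_compl]
  simp

/-- The excluded strings that satisfy the third condition are determined by their first `s + 1`
letters. -/
lemma ncard_excluded_almostPeriodic (s : ℕ) (hs : 1 ≤ s) :
    {x : Vtx d (2 * s + 1) | letters x (2 * s) - letters x s = excludedDiff s (letters x) ∧
      ∀ i, i + 1 < s → letters x i = letters x (i + s + 1)}.ncard = d ^ (s + 1) := by
  set ρ : Vtx d (s + 1) → ℕ → Fin d := fun v i => letters v (i % (s + 1)) with hρ
  set φ : Vtx d (s + 1) → Vtx d (2 * s + 1) := fun v =>
    ofLetters _ (Function.update (ρ v) (2 * s) (letters v s + excludedDiff s (ρ v))) with hφ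
  have low : ∀ v, ∀ i < 2 * s, letters (φ v) i = ρ v i := by
    intro v i hi
    rw [hφ, letters_ofLetters _ (by omega), Function.update_of_ne (by omega)]
  have high : ∀ v, letters (φ v) (2 * s) = letters v s + excludedDiff s (ρ v) := by
    intro v
    rw [hφ, letters_ofLetters _ (by omega), Function.update_self]
  have start : ∀ v, ∀ i < s + 1, ρ v i = letters v i := by
    intro v i hi
    simp [hρ, Nat.mod_eq_of_lt hi]
  have hinj : Function.Injective φ := by
    intro v v' h
    funext i
    rw [← letters_of_lt v i.isLt, ← letters_of_lt v' i.isLt, ← start v i i.isLt,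
      ← start v' i i.isLt, ← low v i (by omega), h, low v' i (by omega)]
  have hrange : {x : Vtx d (2 * s + 1) |
      letters x (2 * s) - letters x s = excludedDiff s (letters x) ∧
      ∀ i, i + 1 < s → letters x i = letters x (i + s + 1)} = Set.range φ := by
    ext x
    constructor
    · rintro ⟨hx, hper⟩
      have hw : ∀ i < s + 1, letters (ofLetters (s + 1) (letters x)) i = letters x i :=
        fun i hi => letters_ofLetters _ hi
      have hw' : ∀ i < 2 * s, ρ (ofLetters (s + 1) (letters x)) i = letters x i := by
        intro i hi
        rcases lt_or_ge i (s + 1) with hlt | hge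
        · rw [start _ _ hlt, hw _ hlt]
        · simp only [hρ]
          rw [Nat.mod_eq_sub_mod hge, Nat.mod_eq_of_lt (by omega), hw _ (by omega),
            hper _ (by omega)]
          congr 1
          omega
      refine ⟨ofLetters (s + 1) (letters x), ?_⟩
      funext i
      rw [← letters_of_lt (φ _) i.isLt, ← letters_of_lt x i.isLt]
      rcases Nat.lt_succ_iff_lt_or_eq.1 i.isLt with hi | hi
      · rw [low _ _ hi, hw' _ hi]
      · rw [hi, high, hw s (by omega), excludedDiff_congr fun i hi _ => hw' i hi, ← hx]
        abel
    · rintro ⟨v, rfl⟩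
      refine ⟨?_, fun i hi => ?_⟩
      · rw [high, low v s (by omega), start v s (by omega),
          excludedDiff_congr fun i hi _ => low v i hi, add_sub_cancel_left]
      · rw [low v i (by omega), low v _ (by omega)]
        simp [hρ, add_assoc]
  rw [hrange, ← Set.image_univ, Set.ncard_image_of_injective _ hinj, Set.ncard_univ,
    Nat.card_eq_fintype_card]
  simp

lemma ncard_inCode (s : ℕ) (hs : 1 ≤ s) :
    {x : Vtx d (2 * s + 1) | InCode s (letters x)}.ncard =
      d ^ (2 * s) * (d - 1) + d ^ (s + 1) := by
  rw [← ncard_not_excluded s hs, ← ncard_excluded_almostPeriodic s hs, ← Set.ncard_union_eq]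
  · congr 1
    ext x
    simp only [InCode, Set.mem_ofPred_eq, Set.mem_union]
    tauto
  · rw [Set.disjoint_left]
    exact fun x hx hx' => hx hx'.1

end Strings

/-- Theorem `MPT11`: for `d ≥ 2` and `n = 2t − 1 ≥ 5`, the given set `S`
is a `t`-identifying code of `B⃗(d,n)` of cardinality `d^{n−1}(d−1) + d^t`. -/
theorem stmt5 (d n t : ℕ) (hd : 2 ≤ d) (hn : 5 ≤ n) (hnt : n = 2 * t - 1)
    (S : Set (Vtx d n))
    (hS : S =
      {x : Vtx d n |
        (∃ m : Fin d, ∃ ℓ : ℕ, ∃ _ : 1 ≤ ℓ, ∃ _ : ℓ < t - 1,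
          IsPeriodic
            (substr (modify x (t - 1) m) (t + 1 - ℓ) (n - 1) (by omega) (by omega)) ℓ ∧
          ¬ IsPeriodic
            (Fin.snoc
              (substr (modify x (t - 1) m) (t + 1 - ℓ) (n - 1) (by omega) (by omega))
              (x ⟨n - 1, by omega⟩ + m)) ℓ) ∨
        (x ⟨t - 1, by omega⟩ ≠ x ⟨n - 1, by omega⟩ ∧
          ∀ m : Fin d, ∀ ℓ : ℕ, 1 ≤ ℓ → ∀ _ : ℓ < t - 1,
            ¬ IsPeriodic
              (substr (modify x (t - 1) m) (t + 1 - ℓ) (n - 1) (by omega) (by omega)) ℓ) ∨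
        (∃ m : Fin d,
          AlmostPeriodic (substr (modify x (t - 1) m) 1 (n - 1) (by omega) (by omega)) t)}) :
    IsIdCode d n t S ∧ S.ncard = d ^ (n - 1) * (d - 1) + d ^ t := by
  have : NeZero d := ⟨by omega⟩
  obtain ⟨s, rfl⟩ : ∃ s, t = s + 1 := ⟨t - 1, by omega⟩
  obtain rfl : n = 2 * s + 1 := by omega
  have hcode : S = {x : Vtx d (2 * s + 1) | InCode s (letters x)} := by
    rw [hS]
    ext x
    exact code_conditions_iff hd x _ _ _
  rw [hcode]
  exact ⟨isIdCode_inCode hd (by omega), ncard_inCode s (by omega)⟩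

end DeBruijnPaper
end

section
/- For d ≥ 2 and n ≥ 2, the directed metric dimension of the directed de Bruijn graph B⃗(d,n) is exactly d^{n−1}(d−1). -/
/- Common framework: the directed de Bruijn graph B⃗(d,n).
Vertices are strings of length `n` over the alphabet `A_d = Fin d`,
modelled as functions `Fin n → Fin d` (0-indexed; the paper's 1-indexed
position `i` corresponds to index `i - 1` here). -/

namespace DeBruijnPaper

theorem hasWalk_self (d n : ℕ) (u : Vtx d n) : hasWalk d n 0 u u :=
  ⟨fun _ => u, rfl, rfl, fun _ h => absurd h (Nat.not_lt_zero _)⟩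

/-- Any vertex can be reached in `n` steps, by shifting in its letters one at a time. -/
theorem hasWalk_length (d n : ℕ) (u v : Vtx d n) : hasWalk d n n u v := by
  refine ⟨fun t i => if h : t + i < n then u ⟨t + i, h⟩
    else v ⟨(t + i - n) % n, Nat.mod_lt _ i.pos⟩, ?_, ?_, ?_⟩
  · funext i
    simp
  · funext i
    simp [Nat.mod_eq_of_lt i.isLt]
  · intro t _ i h
    simp only [show t + 1 + i = t + (i + 1) by omega]

theorem hasWalk_dirDist (d n : ℕ) (u v : Vtx d n) : hasWalk d n (dirDist d n u v) u v :=
  Nat.sInf_mem (s := {t : ℕ | hasWalk d n t u v}) ⟨n, hasWalk_length d n u v⟩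

theorem hasWalk_zero_iff {d n : ℕ} {u v : Vtx d n} : hasWalk d n 0 u v ↔ u = v := by
  constructor
  · rintro ⟨f, h₀, h₁, -⟩
    exact h₀.symm.trans h₁
  · rintro rfl
    exact hasWalk_self d n u

theorem hasWalk_one_iff {d n : ℕ} {u v : Vtx d n} : hasWalk d n 1 u v ↔ adj d n u v := by
  constructor
  · rintro ⟨f, rfl, rfl, h⟩
    exact h 0 one_pos
  · intro h
    refine ⟨fun t => if t = 0 then u else v, by simp, by simp, fun i hi => ?_⟩
    obtain rfl : i = 0 := by omega
    simpa using h

theorem dirDist_eq_zero_iff {d n : ℕ} {u v : Vtx d n} : dirDist d n u v = 0 ↔ u = v := by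
  constructor
  · intro h
    exact hasWalk_zero_iff.1 (h ▸ hasWalk_dirDist d n u v)
  · intro h
    exact Nat.le_zero.1 (Nat.sInf_le (hasWalk_zero_iff.2 h))

theorem dirDist_eq_one_iff {d n : ℕ} {u v : Vtx d n} :
    dirDist d n u v = 1 ↔ u ≠ v ∧ adj d n u v := by
  constructor
  · intro h
    refine ⟨fun huv => ?_, hasWalk_one_iff.1 (h ▸ hasWalk_dirDist d n u v)⟩
    rw [dirDist_eq_zero_iff.2 huv] at h
    exact zero_ne_one h
  · rintro ⟨hne, hadj⟩
    have hle : dirDist d n u v ≤ 1 := Nat.sInf_le (hasWalk_one_iff.2 hadj)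
    have hzero : dirDist d n u v ≠ 0 := fun h => hne (dirDist_eq_zero_iff.1 h)
    omega

theorem adj_congr_right {d m : ℕ} {x u v : Vtx d (m + 1)} (h : Fin.init u = Fin.init v) :
    adj d (m + 1) x u ↔ adj d (m + 1) x v := by
  have key : ∀ (i : ℕ) (hi : i + 1 < m + 1), u ⟨i, by omega⟩ = v ⟨i, by omega⟩ :=
    fun i hi => congrFun h ⟨i, by omega⟩
  exact forall₂_congr fun i hi => by rw [key i hi]

theorem hasWalk_succ_iff {d n t : ℕ} {s u : Vtx d n} :
    hasWalk d n (t + 1) s u ↔ ∃ w, hasWalk d n t s w ∧ adj d n w u := by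
  constructor
  · rintro ⟨f, h₀, rfl, h⟩
    exact ⟨f t, ⟨f, h₀, rfl, fun i hi => h i (by omega)⟩, h t (by omega)⟩
  · rintro ⟨_, ⟨f, h₀, rfl, h⟩, hadj⟩
    refine ⟨Function.update f (t + 1) u, by simpa using h₀, by simp, fun i hi => ?_⟩
    rw [Function.update_of_ne (by omega)]
    rcases Nat.lt_succ_iff_lt_or_eq.1 hi with hi | rfl
    · rw [Function.update_of_ne (by omega)]
      exact h i hi
    · simpa using hadj

/-- Two vertices with the same first `m` letters have the same distance from any third vertex. -/
theorem dirDist_congr_right {d m : ℕ} {s u v : Vtx d (m + 1)} (h : Fin.init u = Fin.init v)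
    (hu : s ≠ u) (hv : s ≠ v) : dirDist d (m + 1) s u = dirDist d (m + 1) s v := by
  unfold dirDist
  congr 1
  ext t
  cases t with
  | zero => simp [hasWalk_zero_iff, hu, hv]
  | succ t => simp only [Set.mem_ofPred_eq, hasWalk_succ_iff, adj_congr_right h]

theorem IsResolving.le_ncard {d m : ℕ} {S : Set (Vtx d (m + 1))}
    (hS : IsResolving d (m + 1) S) : d ^ m * (d - 1) ≤ S.ncard := by
  have hinj : Set.InjOn (fun w : Vtx d (m + 1) => (Fin.init w : Vtx d m)) Sᶜ := by
    intro u hu v hv huv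
    by_contra hne
    obtain ⟨s, hs, hdist⟩ := hS u v hne
    exact hdist (dirDist_congr_right huv (fun h => hu (h ▸ hs)) (fun h => hv (h ▸ hs)))
  have hle := Set.ncard_le_ncard_of_injOn (t := Set.univ) _ (fun _ _ => Set.mem_univ _) hinj
  have hcompl := Set.ncard_add_ncard_compl S
  simp only [Set.ncard_univ, Nat.card_eq_fintype_card, Fintype.card_fun, Fintype.card_fin] at *
  rw [Nat.mul_sub, ← pow_succ, mul_one]
  omega

/-- The strings whose last letter differs from their first letter. -/
def endsDiffer (d m : ℕ) : Set (Vtx d (m + 1)) :=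
  {w | w (Fin.last m) ≠ w 0}

theorem isResolving_endsDiffer {d m : ℕ} (hd : 2 ≤ d) :
    IsResolving d (m + 2) (endsDiffer d (m + 1)) := by
  intro u v huv
  by_cases hu : u ∈ endsDiffer d (m + 1)
  · refine ⟨u, hu, fun h => huv ?_⟩
    rwa [dirDist_eq_zero_iff.2 rfl, eq_comm, dirDist_eq_zero_iff] at h
  by_cases hv : v ∈ endsDiffer d (m + 1)
  · refine ⟨v, hv, fun h => huv ?_⟩
    rwa [dirDist_eq_zero_iff.2 (rfl : v = v), dirDist_eq_zero_iff, eq_comm] at h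
  have hinit : Fin.init u ≠ Fin.init v := by
    intro h
    simp only [endsDiffer, Set.mem_ofPred_eq, not_not] at hu hv
    have h₀ : u 0 = v 0 := congrFun h 0
    refine huv (funext fun i => ?_)
    induction i using Fin.lastCases with
    | last => rw [hu, hv, h₀]
    | cast i => exact congrFun h i
  have : Nontrivial (Fin d) := Fin.nontrivial_iff_two_le.2 hd
  obtain ⟨x, hx⟩ := exists_ne ((Fin.init u : Vtx d (m + 1)) (Fin.last m))
  set s : Vtx d (m + 2) := Fin.cons x (Fin.init u : Vtx d (m + 1)) with hs
  have hsmem : s ∈ endsDiffer d (m + 1) := by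
    simp only [endsDiffer, Set.mem_ofPred_eq, hs, ← Fin.succ_last, Fin.cons_succ, Fin.cons_zero]
    exact hx.symm
  have hadj : s ≠ u ∧ adj d (m + 2) s u := ⟨fun h => hu (h ▸ hsmem), fun _ _ => rfl⟩
  refine ⟨s, hsmem, fun h => ?_⟩
  rw [dirDist_eq_one_iff.2 hadj, eq_comm, dirDist_eq_one_iff] at h
  refine hinit (funext fun i => ?_)
  exact h.2 i (by omega)

theorem ncard_endsDiffer_le (d m : ℕ) :
    (endsDiffer d (m + 1)).ncard ≤ d ^ (m + 1) * (d - 1) := by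
  have hinj : Function.Injective
      (fun p : Vtx d (m + 1) => (Fin.snoc p (p 0) : Vtx d (m + 2))) := by
    intro p q h
    simpa using congrArg (fun w : Vtx d (m + 2) => (Fin.init w : Vtx d (m + 1))) h
  have hsub : Set.range (fun p : Vtx d (m + 1) => (Fin.snoc p (p 0) : Vtx d (m + 2))) ⊆
      (endsDiffer d (m + 1))ᶜ := by
    rintro _ ⟨p, rfl⟩
    simp only [endsDiffer, Set.mem_compl_iff, Set.mem_ofPred_eq, not_not, Fin.snoc_last]
    rfl
  have hle := Set.ncard_le_ncard hsub
  rw [Set.ncard_range_of_injective hinj] at hle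
  have hcompl := Set.ncard_add_ncard_compl (endsDiffer d (m + 1))
  simp only [Nat.card_eq_fintype_card, Fintype.card_fun, Fintype.card_fin] at *
  rw [Nat.mul_sub, ← pow_succ, mul_one]
  omega

/-- the directed metric dimension of `B⃗(d,n)` is exactly `d^{n−1}(d−1)`. -/
theorem stmt10 (d n : ℕ) (hd : 2 ≤ d) (hn : 2 ≤ n) :
    metricDim d n = d ^ (n - 1) * (d - 1) := by
  obtain ⟨m, rfl⟩ : ∃ m, n = m + 2 := ⟨n - 2, by omega⟩
  rw [show m + 2 - 1 = m + 1 from rfl]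
  have hres := isResolving_endsDiffer (m := m) hd
  refine le_antisymm (le_trans (Nat.sInf_le ⟨_, hres, rfl⟩) (ncard_endsDiffer_le d m)) ?_
  refine le_csInf ⟨_, endsDiffer d (m + 1), hres, rfl⟩ ?_
  rintro _ ⟨S, hS, rfl⟩
  exact hS.le_ncard

end DeBruijnPaper
end
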